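/- In the Marsh–Rietsch setup over ℝ with all parameters t_r > 0: the matrix gᵀ·ẇ admits a UDL factorization gᵀẇ = y₊·y₀·y₋, the matrix ẇ·y₋·ẇ⁻¹ is upper unitriangular, and, setting z := (ẇ·y₋·ẇ⁻¹)ᵀ, for every i ∈ {1,…,n−1} and every r ∈ {1,…,m+1} one has Δ^{A}_{B}(y₊·y₀) = Δ^{R}_{C}(zᵀ), where A := (s^v_{i_m}∘s^v_{i_{m−1}}∘···∘s^v_{i_r})({1,…,i}), B := (s_{i_m}∘s_{i_{m−1}}∘···∘s_{i_r})({1,…,i}), R := (s_{i_1}∘s_{i_2}∘···∘s_{i_{r−1}})({i+1,…,n}), and C := (s^v_{i_1}∘s^v_{i_2}∘···∘s^v_{i_{r−1}})({i+1,…,n}) (empty compositions denote the identity permutation). -/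

import Mathlib

open Matrix Finset

namespace Paper

open scoped Classical

noncomputable section

variable {K : Type*} [Field K] {n m : ℕ}

/-- `N`: upper unitriangular matrices. -/
def IsN (g : Matrix (Fin n) (Fin n) K) : Prop :=
  (∀ i, g i i = 1) ∧ ∀ i j : Fin n, j < i → g i j = 0

/-- `N₋`: lower unitriangular matrices. -/
def IsNm (g : Matrix (Fin n) (Fin n) K) : Prop :=
  (∀ i, g i i = 1) ∧ ∀ i j : Fin n, i < j → g i j = 0

/-- `B`: upper triangular matrices of determinant 1. -/
def IsB (g : Matrix (Fin n) (Fin n) K) : Prop :=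
  g.det = 1 ∧ ∀ i j : Fin n, j < i → g i j = 0

/-- `B₋`: lower triangular matrices of determinant 1. -/
def IsBm (g : Matrix (Fin n) (Fin n) K) : Prop :=
  g.det = 1 ∧ ∀ i j : Fin n, i < j → g i j = 0

/-- `H`: diagonal matrices of determinant 1. -/
def IsH (g : Matrix (Fin n) (Fin n) K) : Prop :=
  g.det = 1 ∧ ∀ i j : Fin n, i ≠ j → g i j = 0

/-- UDL factorization: `g = yp * y0 * ym` with `yp ∈ N`, `y0 ∈ H`, `ym ∈ N₋`. -/
def UDL (g yp y0 ym : Matrix (Fin n) (Fin n) K) : Prop :=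
  IsN yp ∧ IsH y0 ∧ IsNm ym ∧ g = yp * y0 * ym

/-- LDU factorization: `g = zm * z0 * zp` with `zm ∈ N₋`, `z0 ∈ H`, `zp ∈ N`. -/
def LDU (g zm z0 zp : Matrix (Fin n) (Fin n) K) : Prop :=
  IsNm zm ∧ IsH z0 ∧ IsN zp ∧ g = zm * z0 * zp

/-- The signed permutation matrix `v̇`. -/
def pdot (v : Equiv.Perm (Fin n)) : Matrix (Fin n) (Fin n) K :=
  Matrix.of fun a b : Fin n =>
    if a = v b then
      (-1 : K) ^ (univ.filter fun k : Fin n => b < k ∧ v k < v b).card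
    else 0

/-- Membership in the double coset `B₋ w B₋`. -/
def InBmWBm (w : Equiv.Perm (Fin n)) (g : Matrix (Fin n) (Fin n) K) : Prop :=
  ∃ b₁ b₂ : Matrix (Fin n) (Fin n) K, IsBm b₁ ∧ IsBm b₂ ∧ g = b₁ * pdot w * b₂

/-- `Δ^I_J(g)`: the minor with row set `I` and column set `J` (junk value 0 if sizes differ). -/
def minor (g : Matrix (Fin n) (Fin n) K) (I J : Finset (Fin n)) : K :=
  if h : I.card = J.card then
    Matrix.det (Matrix.of fun a b : Fin I.card =>
      g (I.orderEmbOfFin rfl a) (J.orderEmbOfFin h.symm b))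
  else 0

/-- All right-aligned flag minors of `g` are nonnegative. -/
def RightFlagNonneg (g : Matrix (Fin n) (Fin n) ℝ) : Prop :=
  ∀ I : Finset (Fin n),
    0 ≤ minor g I (univ.filter fun j : Fin n => n - I.card ≤ (j : ℕ))

/-- All top-aligned flag minors of `g` are nonnegative. -/
def TopFlagNonneg (g : Matrix (Fin n) (Fin n) ℝ) : Prop :=
  ∀ J : Finset (Fin n),
    0 ≤ minor g (univ.filter fun i : Fin n => (i : ℕ) < J.card) J

/-- `x_i(t)` (with 1-based `i`): `Id + t·E_{i,i+1}`. -/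
def xmat (i : ℕ) (t : K) : Matrix (Fin n) (Fin n) K :=
  Matrix.of fun a b : Fin n =>
    if a = b then 1 else if (a : ℕ) + 1 = i ∧ (b : ℕ) = i then t else 0

/-- `y_i(t)` (with 1-based `i`): `Id + t·E_{i+1,i}`. -/
def ymat (i : ℕ) (t : K) : Matrix (Fin n) (Fin n) K :=
  Matrix.of fun a b : Fin n =>
    if a = b then 1 else if (a : ℕ) = i ∧ (b : ℕ) + 1 = i then t else 0

/-- `ṡ_i` (with 1-based `i`). -/
def sdot (i : ℕ) : Matrix (Fin n) (Fin n) K :=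
  Matrix.of fun a b : Fin n =>
    if (a : ℕ) + 1 = i ∧ (b : ℕ) = i then 1
    else if (a : ℕ) = i ∧ (b : ℕ) + 1 = i then -1
    else if a = b ∧ (a : ℕ) + 1 ≠ i ∧ (a : ℕ) ≠ i then 1
    else 0

/-- The adjacent transposition `s_i` (with 1-based `i`); identity if out of range. -/
def sperm (n : ℕ) (i : ℕ) : Equiv.Perm (Fin n) :=
  if h : i < n then
    Equiv.swap ⟨i - 1, Nat.lt_of_le_of_lt (Nat.sub_le i 1) h⟩ ⟨i, h⟩
  else 1

/-- `ℓ(w)`: the number of inversions of `w`. -/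
def len (w : Equiv.Perm (Fin n)) : ℕ :=
  (univ.filter fun p : Fin n × Fin n => p.1 < p.2 ∧ w p.2 < w p.1).card

/-- `vseq ii v k = v_{(m-k)}`: the rightmost (positive distinguished) subexpression recursion. -/
def vseq (ii : Fin m → ℕ) (v : Equiv.Perm (Fin n)) : ℕ → Equiv.Perm (Fin n)
  | 0 => v
  | k + 1 =>
    if h : m - k - 1 < m then
      if len (vseq ii v k * sperm n (ii ⟨m - k - 1, h⟩)) < len (vseq ii v k) then
        vseq ii v k * sperm n (ii ⟨m - k - 1, h⟩)
      else vseq ii v k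
    else vseq ii v k

/-- `r ∈ J°` (0-based `r`, corresponding to the 1-based index `r+1`). -/
def inJ (ii : Fin m → ℕ) (v : Equiv.Perm (Fin n)) (r : Fin m) : Prop :=
  vseq ii v (m - (r : ℕ)) = vseq ii v (m - (r : ℕ) - 1)

/-- The list `[s_{i_1}, …, s_{i_m}]` of adjacent transpositions. -/
def sPermList (n : ℕ) (ii : Fin m → ℕ) : List (Equiv.Perm (Fin n)) :=
  List.ofFn fun r => sperm n (ii r)

/-- The list `[s^v_{i_1}, …, s^v_{i_m}]`. -/
def svPermList (ii : Fin m → ℕ) (v : Equiv.Perm (Fin n)) : List (Equiv.Perm (Fin n)) :=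
  List.ofFn fun r => if inJ ii v r then 1 else sperm n (ii r)

/-- The factors `g_1, …, g_m` of the Marsh–Rietsch element. -/
def mrgList (ii : Fin m → ℕ) (v : Equiv.Perm (Fin n)) (t : Fin m → K) :
    List (Matrix (Fin n) (Fin n) K) :=
  List.ofFn fun r => if inJ ii v r then xmat (ii r) (t r) else sdot (ii r)

/-- The Marsh–Rietsch element `g = g_1 ⋯ g_m`. -/
def mrg (ii : Fin m → ℕ) (v : Equiv.Perm (Fin n)) (t : Fin m → K) :
    Matrix (Fin n) (Fin n) K :=
  (mrgList ii v t).prod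

/-- The list `[ṡ_{i_1}, …, ṡ_{i_m}]`. -/
def sdotList (n : ℕ) (ii : Fin m → ℕ) : List (Matrix (Fin n) (Fin n) K) :=
  List.ofFn fun r => sdot (ii r)

/-- `ẇ = ṡ_{i_1} ⋯ ṡ_{i_m}`. -/
def wMR (n : ℕ) (ii : Fin m → ℕ) : Matrix (Fin n) (Fin n) K :=
  (sdotList n ii).prod


/-! Adjacent transpositions. -/

lemma sperm_invol (j : ℕ) (x : Fin n) : sperm n j (sperm n j x) = x := by
  unfold sperm
  split_ifs <;> simp

lemma sperm_mul_self (j : ℕ) : sperm n j * sperm n j = 1 := by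
  ext x; simp [sperm_invol]

lemma sperm_inv (j : ℕ) : (sperm n j)⁻¹ = sperm n j :=
  inv_eq_of_mul_eq_one_left (sperm_mul_self j)

lemma sperm_val {j : ℕ} (h1 : 1 ≤ j) (h2 : j < n) (x : Fin n) :
    ((sperm n j x : Fin n) : ℕ) = if (x : ℕ) = j then j - 1 else
      if (x : ℕ) + 1 = j then j else (x : ℕ) := by
  unfold sperm
  rw [dif_pos h2, Equiv.swap_apply_def]
  simp only [Fin.ext_iff]
  split_ifs <;> (try dsimp only) <;> omega

lemma sperm_lt {j : ℕ} (h1 : 1 ≤ j) (h2 : j < n) {x y : Fin n} (h : x < y)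
    (hne : ¬ ((x : ℕ) + 1 = j ∧ (y : ℕ) = j)) : sperm n j x < sperm n j y := by
  rw [Fin.lt_def] at *
  rw [sperm_val h1 h2, sperm_val h1 h2]
  split_ifs <;> omega

lemma len_mul_sperm {j : ℕ} (h1 : 1 ≤ j) (h2 : j < n) (x : Equiv.Perm (Fin n))
    (h : x ⟨j - 1, by omega⟩ < x ⟨j, h2⟩) : len (x * sperm n j) = len x + 1 := by
  have ea : sperm n j ⟨j - 1, by omega⟩ = ⟨j, h2⟩ := by
    apply Fin.ext; rw [sperm_val h1 h2]; dsimp only; split_ifs <;> omega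
  have eb : sperm n j ⟨j, h2⟩ = ⟨j - 1, by omega⟩ := by
    apply Fin.ext; rw [sperm_val h1 h2]; simp
  unfold len
  set a : Fin n := ⟨j - 1, by omega⟩ with ha
  set b : Fin n := ⟨j, h2⟩ with hb
  have hmem : (a, b) ∈ univ.filter fun p : Fin n × Fin n =>
      p.1 < p.2 ∧ (x * sperm n j) p.2 < (x * sperm n j) p.1 := by
    rw [Finset.mem_filter]
    simp only [Equiv.Perm.mul_apply, ea, eb]
    exact ⟨mem_univ _, by rw [Fin.lt_def]; simp [ha, hb]; omega, h⟩
  have key : ∀ p q : Fin n, p < q → ¬ (p = a ∧ q = b) → sperm n j p < sperm n j q := by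
    intro p q hpq hne
    apply sperm_lt h1 h2 hpq
    rintro ⟨e1, e2⟩
    apply hne
    constructor <;> apply Fin.ext <;> simp [ha, hb] <;> omega
  rw [← Finset.card_erase_add_one hmem]
  congr 1
  refine Finset.card_nbij' (fun p => (sperm n j p.1, sperm n j p.2))
    (fun p => (sperm n j p.1, sperm n j p.2)) ?_ ?_ ?_ ?_
  · rintro ⟨p, q⟩ hp
    rw [Finset.mem_coe] at hp ⊢
    rw [Finset.mem_erase, Finset.mem_filter] at hp
    rw [Finset.mem_filter]
    simp only [ne_eq, Prod.mk.injEq, Equiv.Perm.mul_apply] at hp ⊢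
    exact ⟨mem_univ _, key _ _ hp.2.2.1 hp.1, hp.2.2.2⟩
  · rintro ⟨p, q⟩ hp
    rw [Finset.mem_coe] at hp ⊢
    rw [Finset.mem_erase, Finset.mem_filter]
    rw [Finset.mem_filter] at hp
    replace hp := hp.2
    simp only [ne_eq, Prod.mk.injEq, Equiv.Perm.mul_apply, sperm_invol] at hp ⊢
    refine ⟨?_, mem_univ _, key _ _ hp.1 ?_, hp.2⟩
    rotate_left
    · rintro ⟨rfl, rfl⟩
      exact absurd hp.2 (not_lt.2 h.le)
    · rintro ⟨e1, e2⟩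
      have e1' : p = b := by rw [← sperm_invol j p, e1, ea]
      have e2' : q = a := by rw [← sperm_invol j q, e2, eb]
      have := hp.1
      rw [e1', e2', Fin.lt_def] at this
      simp [ha, hb] at this
      omega
  · rintro ⟨p, q⟩ _; simp [sperm_invol]
  · rintro ⟨p, q⟩ _; simp [sperm_invol]

lemma len_mul_sperm' {j : ℕ} (h1 : 1 ≤ j) (h2 : j < n) (x : Equiv.Perm (Fin n))
    (h : ¬ x ⟨j - 1, by omega⟩ < x ⟨j, h2⟩) : len x = len (x * sperm n j) + 1 := by
  have ea : sperm n j ⟨j - 1, by omega⟩ = ⟨j, h2⟩ := by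
    apply Fin.ext; rw [sperm_val h1 h2]; dsimp only; split_ifs <;> omega
  have eb : sperm n j ⟨j, h2⟩ = ⟨j - 1, by omega⟩ := by
    apply Fin.ext; rw [sperm_val h1 h2]; simp
  have := len_mul_sperm h1 h2 (x * sperm n j) (by
    simp only [Equiv.Perm.mul_apply, ea, eb]
    refine lt_of_le_of_ne (not_lt.1 h) ?_
    intro e
    have := x.injective e
    simp [Fin.ext_iff] at this
    omega)
  rwa [mul_assoc, sperm_mul_self, mul_one] at this

lemma len_inv (x : Equiv.Perm (Fin n)) : len x⁻¹ = len x := by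
  unfold len
  refine Finset.card_nbij' (fun p => (x⁻¹ p.2, x⁻¹ p.1)) (fun p => (x p.2, x p.1)) ?_ ?_ ?_ ?_
  · rintro ⟨p, q⟩ hp; simpa [and_comm] using hp
  · rintro ⟨p, q⟩ hp; simpa [and_comm] using hp
  · rintro ⟨p, q⟩ _; simp
  · rintro ⟨p, q⟩ _; simp

lemma len_one : len (1 : Equiv.Perm (Fin n)) = 0 := by
  unfold len
  rw [Finset.card_eq_zero, Finset.filter_eq_empty_iff]
  rintro ⟨p, q⟩ _ ⟨h1, h2⟩
  exact absurd h1 (not_lt.2 (le_of_lt h2))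

/-- product of a word -/
def ppi (n : ℕ) (l : List ℕ) : Equiv.Perm (Fin n) := (l.map (sperm n)).prod

lemma ppi_append (l l' : List ℕ) : ppi n (l ++ l') = ppi n l * ppi n l' := by simp [ppi]
lemma ppi_cons (j : ℕ) (l : List ℕ) : ppi n (j :: l) = sperm n j * ppi n l := by simp [ppi]
lemma ppi_nil : ppi n [] = 1 := by simp [ppi]
lemma ppi_single (j : ℕ) : ppi n [j] = sperm n j := by simp [ppi]

/-- good letters -/
def Gd (n : ℕ) (l : List ℕ) : Prop := ∀ j ∈ l, 1 ≤ j ∧ j < n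

lemma len_mul_sperm_le {j : ℕ} (h1 : 1 ≤ j) (h2 : j < n) (x : Equiv.Perm (Fin n)) :
    len (x * sperm n j) ≤ len x + 1 := by
  by_cases h : x ⟨j - 1, by omega⟩ < x ⟨j, h2⟩
  · exact (len_mul_sperm h1 h2 x h).le
  · have := len_mul_sperm' h1 h2 x h
    omega

lemma len_sperm_mul_le {j : ℕ} (h1 : 1 ≤ j) (h2 : j < n) (x : Equiv.Perm (Fin n)) :
    len (sperm n j * x) ≤ len x + 1 := by
  have := len_mul_sperm_le h1 h2 x⁻¹
  rwa [len_inv, ← len_inv, _root_.mul_inv_rev, inv_inv, sperm_inv] at this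

lemma len_mul_ppi_le (l : List ℕ) (hl : Gd n l) (x : Equiv.Perm (Fin n)) :
    len (x * ppi n l) ≤ len x + l.length := by
  induction l generalizing x with
  | nil => simp [ppi_nil]
  | cons j l ih =>
    rw [ppi_cons, ← mul_assoc]
    have h := hl j (by simp)
    have := ih (fun k hk => hl k (by simp [hk])) (x * sperm n j)
    have := len_mul_sperm_le h.1 h.2 x
    simp; omega

lemma len_ppi_mul_le (l : List ℕ) (hl : Gd n l) (x : Equiv.Perm (Fin n)) :
    len (ppi n l * x) ≤ len x + l.length := by
  induction l generalizing x with
  | nil => simp [ppi_nil]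
  | cons j l ih =>
    rw [ppi_cons, mul_assoc]
    have h := hl j (by simp)
    have := ih (fun k hk => hl k (by simp [hk])) x
    have := len_sperm_mul_le h.1 h.2 (ppi n l * x)
    simp; omega

/-- reduced words -/
def Rd (n : ℕ) (l : List ℕ) : Prop := Gd n l ∧ len (ppi n l) = l.length

lemma Gd.left {l l' : List ℕ} (h : Gd n (l ++ l')) : Gd n l := fun j hj => h j (by simp [hj])
lemma Gd.right {l l' : List ℕ} (h : Gd n (l ++ l')) : Gd n l' := fun j hj => h j (by simp [hj])

lemma Rd.left {l l' : List ℕ} (h : Rd n (l ++ l')) : Rd n l := by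
  refine ⟨h.1.left, ?_⟩
  have h2 := h.2
  rw [ppi_append, List.length_append] at h2
  have := len_mul_ppi_le l' h.1.right (ppi n l)
  have := len_mul_ppi_le l h.1.left 1
  rw [one_mul, len_one] at this
  omega

lemma Rd.right {l l' : List ℕ} (h : Rd n (l ++ l')) : Rd n l' := by
  refine ⟨h.1.right, ?_⟩
  have h2 := h.2
  rw [ppi_append, List.length_append] at h2
  have := len_ppi_mul_le l h.1.left (ppi n l')
  have := len_mul_ppi_le l' h.1.right 1
  rw [one_mul, len_one] at this
  omega

lemma Rd.snoc {l : List ℕ} {j : ℕ} (h : Rd n (l ++ [j])) (a b : Fin n) (ha : (a : ℕ) + 1 = j)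
    (hb : (b : ℕ) = j) : ppi n l a < ppi n l b := by
  have hj := h.1 j (by simp)
  have ea : ∀ h, a = ⟨j - 1, h⟩ := fun _ => Fin.ext (by simp; omega)
  have eb : b = ⟨j, hj.2⟩ := Fin.ext (by simp; omega)
  by_contra hc
  rw [eb, ea (lt_of_le_of_lt (Nat.sub_le _ _) hj.2)] at hc
  have h1 := len_mul_sperm' hj.1 hj.2 _ hc
  have h2 := h.2
  rw [ppi_append, List.length_append, ppi_single] at h2
  have := h.left.2
  simp at h2
  omega

lemma Rd.cons {l : List ℕ} {j : ℕ} (h : Rd n (j :: l)) (a b : Fin n) (ha : (a : ℕ) + 1 = j)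
    (hb : (b : ℕ) = j) : (ppi n l)⁻¹ a < (ppi n l)⁻¹ b := by
  have hj := h.1 j (by simp)
  have ea : ∀ h, a = ⟨j - 1, h⟩ := fun _ => Fin.ext (by simp; omega)
  have eb : b = ⟨j, hj.2⟩ := Fin.ext (by simp; omega)
  by_contra hc
  rw [eb, ea (lt_of_le_of_lt (Nat.sub_le _ _) hj.2)] at hc
  have h1 := len_mul_sperm' hj.1 hj.2 _ hc
  have h2 := h.2
  rw [ppi_cons, ← len_inv, _root_.mul_inv_rev, sperm_inv] at h2
  have : Rd n l := Rd.right (l := [j]) h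
  have := this.2
  rw [len_inv] at h1
  simp at h2
  omega

lemma Rd.mk_snoc {l : List ℕ} {j : ℕ} (h : Rd n l) (h1 : 1 ≤ j) (h2 : j < n)
    (hlt : ∀ a b : Fin n, (a : ℕ) + 1 = j → (b : ℕ) = j → ppi n l a < ppi n l b) :
    Rd n (l ++ [j]) := by
  refine ⟨?_, ?_⟩
  · intro k hk
    rcases List.mem_append.1 hk with hk | hk
    · exact h.1 k hk
    · simp at hk; subst hk; exact ⟨h1, h2⟩
  · rw [ppi_append, ppi_single, len_mul_sperm h1 h2 _ (hlt _ _ (by simp; omega) rfl), h.2]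
    simp

lemma prod_reverse_invol (l : List (Equiv.Perm (Fin n))) (h : ∀ x ∈ l, x⁻¹ = x) :
    l.reverse.prod = l.prod⁻¹ := by
  induction l with
  | nil => simp
  | cons a l ih =>
    rw [List.reverse_cons, List.prod_append, ih (fun x hx => h x (by simp [hx]))]
    simp [h a (by simp)]



/-! Matrices and minors. -/

/-- signs of `sdot` -/
def eps (j : ℕ) (r : Fin n) : ℝ := if (r : ℕ) = j then -1 else 1

lemma eps_sq (j : ℕ) (r : Fin n) : eps j r * eps j r = 1 := by
  unfold eps; split_ifs <;> norm_num

lemma sdot_apply' {j : ℕ} (h1 : 1 ≤ j) (h2 : j < n) (r c : Fin n) :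
    (sdot j : Matrix (Fin n) (Fin n) ℝ) r c = if sperm n j r = c then eps j r else 0 := by
  unfold sdot eps
  simp only [Matrix.of_apply, Fin.ext_iff, sperm_val h1 h2]
  split_ifs <;> first | rfl | omega

lemma sdot_mul_apply {j : ℕ} (h1 : 1 ≤ j) (h2 : j < n) (M : Matrix (Fin n) (Fin n) ℝ)
    (r k : Fin n) : ((sdot j : Matrix (Fin n) (Fin n) ℝ) * M) r k = eps j r * M (sperm n j r) k := by
  rw [Matrix.mul_apply]
  simp [sdot_apply' h1 h2]

lemma mul_sdot_apply {j : ℕ} (h1 : 1 ≤ j) (h2 : j < n) (M : Matrix (Fin n) (Fin n) ℝ)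
    (k c : Fin n) : (M * (sdot j : Matrix (Fin n) (Fin n) ℝ)) k c = M k (sperm n j c) * eps j (sperm n j c) := by
  rw [Matrix.mul_apply]
  have : ∀ x : Fin n, sperm n j x = c ↔ x = sperm n j c := by
    intro x
    constructor
    · rintro rfl; rw [sperm_invol]
    · rintro rfl; rw [sperm_invol]
  simp [sdot_apply' h1 h2, this]

lemma sdotT_mul_apply {j : ℕ} (h1 : 1 ≤ j) (h2 : j < n) (M : Matrix (Fin n) (Fin n) ℝ)
    (r k : Fin n) : ((sdot j : Matrix (Fin n) (Fin n) ℝ)ᵀ * M) r k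
      = eps j (sperm n j r) * M (sperm n j r) k := by
  have := mul_sdot_apply h1 h2 Mᵀ k r
  rw [← Matrix.transpose_apply (Mᵀ * sdot j), Matrix.transpose_mul, Matrix.transpose_transpose]
    at this
  rw [this, Matrix.transpose_apply, mul_comm]

/-- monomial matrices -/
def Mono (W : Matrix (Fin n) (Fin n) ℝ) (w : Equiv.Perm (Fin n)) : Prop :=
  ∃ e : Fin n → ℝ, (∀ c, e c * e c = 1) ∧ ∀ r c, W r c = if r = w c then e c else 0

lemma mono_one : Mono (1 : Matrix (Fin n) (Fin n) ℝ) 1 :=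
  ⟨fun _ => 1, by simp, fun r c => by
    by_cases h : r = (1 : Equiv.Perm (Fin n)) c
    · have h' : r = c := h
      subst h'
      rw [if_pos h]; exact Matrix.one_apply_eq _
    · rw [if_neg h, Matrix.one_apply_ne]; simpa using h⟩

lemma mono_sdot {j : ℕ} (h1 : 1 ≤ j) (h2 : j < n) :
    Mono (sdot j : Matrix (Fin n) (Fin n) ℝ) (sperm n j) := by
  refine ⟨fun c => eps j (sperm n j c), fun c => eps_sq _ _, fun r c => ?_⟩
  rw [sdot_apply' h1 h2]
  by_cases h : r = sperm n j c
  · subst h; simp [sperm_invol]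
  · rw [if_neg h, if_neg]
    rintro rfl
    exact h (sperm_invol _ _).symm

lemma Mono.mul {W W' : Matrix (Fin n) (Fin n) ℝ} {w w' : Equiv.Perm (Fin n)} (h : Mono W w)
    (h' : Mono W' w') : Mono (W * W') (w * w') := by
  obtain ⟨e, he, hW⟩ := h
  obtain ⟨e', he', hW'⟩ := h'
  refine ⟨fun c => e (w' c) * e' c, fun c => ?_, fun r c => ?_⟩
  · calc _ = (e (w' c) * e (w' c)) * (e' c * e' c) := by ring
      _ = 1 := by rw [he, he', one_mul]
  · rw [Matrix.mul_apply]
    by_cases h : r = (w * w') c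
    · rw [if_pos h, h]; simp [hW, hW']
    · rw [if_neg h]
      rw [Equiv.Perm.mul_apply] at h
      simp [hW, hW', h]

lemma Mono.conj {W : Matrix (Fin n) (Fin n) ℝ} {w : Equiv.Perm (Fin n)} (h : Mono W w) :
    ∃ e : Fin n → ℝ, (∀ c, e c * e c = 1) ∧ ∀ M : Matrix (Fin n) (Fin n) ℝ, ∀ r c,
      (Wᵀ * M * W) r c = e r * e c * M (w r) (w c) := by
  obtain ⟨e, he, hW⟩ := h
  refine ⟨e, he, fun M r c => ?_⟩
  simp [Matrix.mul_apply, hW]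
  ring

lemma Mono.T_mul {W : Matrix (Fin n) (Fin n) ℝ} {w : Equiv.Perm (Fin n)} (h : Mono W w) :
    Wᵀ * W = 1 := by
  obtain ⟨e, he, hc⟩ := h.conj
  ext r c
  have := hc 1 r c
  rw [mul_one] at this
  rw [this]
  by_cases hrc : r = c
  · subst hrc; simp [he]
  · simp [hrc]

lemma Mono.mul_T {W : Matrix (Fin n) (Fin n) ℝ} {w : Equiv.Perm (Fin n)} (h : Mono W w) :
    W * Wᵀ = 1 := mul_eq_one_comm.1 h.T_mul

lemma Mono.inv {W : Matrix (Fin n) (Fin n) ℝ} {w : Equiv.Perm (Fin n)} (h : Mono W w) :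
    W⁻¹ = Wᵀ := Matrix.inv_eq_left_inv h.T_mul

lemma Mono.T {W : Matrix (Fin n) (Fin n) ℝ} {w : Equiv.Perm (Fin n)} (h : Mono W w) :
    Mono Wᵀ w⁻¹ := by
  obtain ⟨e, he, hW⟩ := h
  refine ⟨fun c => e (w⁻¹ c), fun c => he _, fun r c => ?_⟩
  rw [Matrix.transpose_apply, hW]
  by_cases h : c = w r
  · subst h; simp
  · rw [if_neg h, if_neg]
    rintro rfl
    simp at h

/-- signed permutation of a word -/
def wd (n : ℕ) (l : List ℕ) : Matrix (Fin n) (Fin n) ℝ := (l.map sdot).prod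

lemma wd_append (l l' : List ℕ) : wd n (l ++ l') = wd n l * wd n l' := by simp [wd]
lemma wd_cons (j : ℕ) (l : List ℕ) : wd n (j :: l) = sdot j * wd n l := by simp [wd]
lemma wd_nil : wd n [] = 1 := by simp [wd]
lemma wd_single (j : ℕ) : wd n [j] = sdot j := by simp [wd]

lemma mono_wd (l : List ℕ) (hl : Gd n l) : Mono (wd n l) (ppi n l) := by
  induction l with
  | nil => rw [wd_nil, ppi_nil]; exact mono_one
  | cons j l ih =>
    rw [wd_cons, ppi_cons]
    have h := hl j (by simp)
    exact (mono_sdot h.1 h.2).mul (ih (fun k hk => hl k (by simp [hk])))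

lemma det_sdot {j : ℕ} (h1 : 1 ≤ j) (h2 : j < n) :
    (sdot j : Matrix (Fin n) (Fin n) ℝ).det = 1 := by
  have : (sdot j : Matrix (Fin n) (Fin n) ℝ) =
      Matrix.of fun r c => eps j r * ((1 : Matrix (Fin n) (Fin n) ℝ).submatrix (sperm n j) id) r c := by
    ext r c
    simp [sdot_apply' h1 h2, Matrix.one_apply]
  rw [this, Matrix.det_mul_column, Matrix.det_permute, Matrix.det_one]
  have hs : Equiv.Perm.sign (sperm n j) = -1 := by
    unfold sperm
    rw [dif_pos h2, Equiv.Perm.sign_swap]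
    simp [Fin.ext_iff]; omega
  have he : ∏ r : Fin n, eps j r = -1 := by
    have : ∀ r : Fin n, eps j r = if r = ⟨j, h2⟩ then -1 else 1 := by
      intro r; simp [eps, Fin.ext_iff]
    simp [this]
  rw [hs, he]; simp

lemma det_wd (l : List ℕ) (hl : Gd n l) : (wd n l).det = 1 := by
  induction l with
  | nil => rw [wd_nil, Matrix.det_one]
  | cons j l ih =>
    rw [wd_cons, Matrix.det_mul]
    have h := hl j (by simp)
    rw [det_sdot h.1 h.2, ih (fun k hk => hl k (by simp [hk])), mul_one]

lemma minor_eq (g : Matrix (Fin n) (Fin n) ℝ) (I J : Finset (Fin n)) {k : ℕ} (hI : I.card = k)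
    (hJ : J.card = k) :
    minor g I J = (g.submatrix (I.orderEmbOfFin hI) (J.orderEmbOfFin hJ)).det := by
  subst hI
  unfold minor
  rw [dif_pos hJ.symm]
  rfl

lemma minor_ne (g : Matrix (Fin n) (Fin n) ℝ) (I J : Finset (Fin n)) (h : I.card ≠ J.card) :
    minor g I J = 0 := by
  unfold minor; rw [dif_neg h]

lemma minor_transpose (g : Matrix (Fin n) (Fin n) ℝ) (I J : Finset (Fin n)) :
    minor gᵀ I J = minor g J I := by
  by_cases h : I.card = J.card
  · rw [minor_eq gᵀ I J h rfl, minor_eq g J I rfl h, ← Matrix.det_transpose]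
    rfl
  · rw [minor_ne _ _ _ h, minor_ne _ _ _ (Ne.symm h)]

lemma minor_mul_of (P X : Matrix (Fin n) (Fin n) ℝ) (I S : Finset (Fin n))
    (hX : ∀ c ∈ S, ∀ k, k ∉ S → X k c = 0) :
    minor (P * X) I S = minor P I S * minor X S S := by
  by_cases h : I.card = S.card
  · rw [minor_eq _ I S h rfl, minor_eq P I S h rfl, minor_eq X S S rfl rfl, ← Matrix.det_mul]
    congr 1
    ext r c
    simp only [Matrix.submatrix_apply, Matrix.mul_apply]
    set f := S.orderEmbOfFin rfl with hf
    have e1 : ∑ x, P (I.orderEmbOfFin h r) x * X x (f c)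
        = ∑ x ∈ S, P (I.orderEmbOfFin h r) x * X x (f c) := by
      symm
      apply Finset.sum_subset (Finset.subset_univ _)
      intro x _ hx
      rw [hX _ (Finset.orderEmbOfFin_mem _ _ _) x hx, mul_zero]
    rw [e1]
    generalize I.orderEmbOfFin h r = y
    rw [← Finset.sum_coe_sort S, ← Equiv.sum_comp (S.orderIsoOfFin rfl).toEquiv]
    rfl
  · rw [minor_ne _ _ _ h, minor_ne _ _ _ h, zero_mul]

lemma det_tri {ι : Type} [Fintype ι] [DecidableEq ι] (f : ι → Fin n) (hf : Function.Injective f)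
    (M : Matrix ι ι ℝ) (h : ∀ r c, f c < f r → M r c = 0) : M.det = ∏ i, M i i := by
  let _ : LinearOrder ι := LinearOrder.lift' f hf
  have := Matrix.det_of_isUpperTriangular (M := M) (fun r c hrc => h r c hrc)
  convert this

lemma minor_tri (X : Matrix (Fin n) (Fin n) ℝ) (S : Finset (Fin n)) (f : Fin n → Fin n)
    (hf : Function.Injective f) (h : ∀ r c, f c < f r → X r c = 0) :
    minor X S S = ∏ c ∈ S, X c c := by
  rw [minor_eq X S S rfl rfl, det_tri (fun k => f (S.orderEmbOfFin rfl k))]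
  · conv_rhs => rw [← Finset.map_orderEmbOfFin_univ S rfl]
    rw [Finset.prod_map]
    rfl
  · exact hf.comp (S.orderEmbOfFin rfl).injective
  · intro r c hrc
    exact h _ _ hrc

lemma perm_apply_inv (x : Equiv.Perm (Fin n)) (a : Fin n) : x (x⁻¹ a) = a := by simp

lemma card_image_perm (x : Equiv.Perm (Fin n)) (S : Finset (Fin n)) : (S.image x).card = S.card :=
  Finset.card_image_of_injective _ x.injective

lemma minor_mul_sdot {j : ℕ} (h1 : 1 ≤ j) (h2 : j < n) (M : Matrix (Fin n) (Fin n) ℝ)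
    (I S : Finset (Fin n))
    (hS : ∀ a b : Fin n, (a : ℕ) + 1 = j → (b : ℕ) = j → b ∈ S → a ∈ S) :
    minor (M * sdot j) I (S.image (sperm n j)) = minor M I S := by
  by_cases h : I.card = S.card
  swap
  · rw [minor_ne _ _ _ h, minor_ne _ _ _ (by rwa [card_image_perm])]
  obtain ⟨a, ha⟩ : ∃ a : Fin n, (a : ℕ) + 1 = j := ⟨⟨j - 1, by omega⟩, by simp; omega⟩
  obtain ⟨b, hb⟩ : ∃ b : Fin n, (b : ℕ) = j := ⟨⟨j, h2⟩, rfl⟩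
  have hsa : sperm n j a = b := by
    apply Fin.ext; rw [sperm_val h1 h2]; split_ifs <;> omega
  have hsb : sperm n j b = a := by rw [← hsa, sperm_invol]
  rw [minor_eq _ I S h rfl, minor_eq _ I (S.image (sperm n j)) h (card_image_perm _ _)]
  set f := S.orderEmbOfFin rfl with hf
  have hfS : ∀ k, f k ∈ S := fun k => Finset.orderEmbOfFin_mem _ _ _
  by_cases hbS : b ∈ S
  · have haS := hS a b ha hb hbS
    have hST : S.image (sperm n j) = S := by
      apply Finset.eq_of_subset_of_card_le
      · intro x hx
        obtain ⟨y, hy, rfl⟩ := Finset.mem_image.1 hx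
        by_cases hya : y = a
        · rw [hya, hsa]; exact hbS
        by_cases hyb : y = b
        · rw [hyb, hsb]; exact haS
        have : sperm n j y = y := by
          rw [Fin.ext_iff] at hya hyb ⊢
          rw [sperm_val h1 h2]; split_ifs <;> omega
        rw [this]; exact hy
      · rw [card_image_perm]
    have hfT : ∀ k, (S.image (sperm n j)).orderEmbOfFin (card_image_perm _ _) k = f k := by
      have : ∀ (T : Finset (Fin n)) (hT : T = S) (hc : T.card = S.card) (k),
          T.orderEmbOfFin hc k = f k := by
        intro T hT hc k; subst hT; rfl
      exact this _ hST _
    obtain ⟨pa, hpa⟩ : ∃ k, f k = a := by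
      have : a ∈ Set.range f := by rw [Finset.range_orderEmbOfFin]; exact haS
      exact this
    obtain ⟨pb, hpb⟩ : ∃ k, f k = b := by
      have : b ∈ Set.range f := by rw [Finset.range_orderEmbOfFin]; exact hbS
      exact this
    have hab : pa ≠ pb := by
      rintro rfl
      have : a = b := by rw [← hpa, hpb]
      rw [Fin.ext_iff] at this; omega
    set σ := Equiv.swap pa pb with hσ
    have hfσ : ∀ k, sperm n j (f k) = f (σ k) := by
      intro k
      by_cases hka : k = pa
      · subst hka; rw [hpa, hsa, hσ, Equiv.swap_apply_left, hpb]
      by_cases hkb : k = pb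
      · subst hkb; rw [hpb, hsb, hσ, Equiv.swap_apply_right, hpa]
      rw [hσ, Equiv.swap_apply_of_ne_of_ne hka hkb]
      have n1 : f k ≠ a := fun e => hka (f.injective (e.trans hpa.symm))
      have n2 : f k ≠ b := fun e => hkb (f.injective (e.trans hpb.symm))
      rw [ne_eq, Fin.ext_iff] at n1 n2
      rw [Fin.ext_iff, sperm_val h1 h2]; split_ifs <;> omega
    have e : (M * sdot j).submatrix (I.orderEmbOfFin h)
        ((S.image (sperm n j)).orderEmbOfFin (card_image_perm _ _)) =
        Matrix.of fun r c => eps j (f (σ c)) * ((M.submatrix (I.orderEmbOfFin h) f).submatrix id σ) r c := by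
      ext r c
      rw [Matrix.submatrix_apply, hfT, mul_sdot_apply h1 h2, hfσ, mul_comm]
      rfl
    rw [e, Matrix.det_mul_row, Matrix.det_permute', Equiv.prod_comp σ (fun k => eps j (f k))]
    have he : ∏ k, eps j (f k) = -1 := by
      have : ∀ k, eps j (f k) = if k = pb then -1 else 1 := by
        intro k
        have : k = pb ↔ ((f k : Fin n) : ℕ) = j := by
          rw [← hb, ← hpb, ← Fin.ext_iff, f.injective.eq_iff]
        simp [eps, this]
      simp [this]
    rw [he, hσ, Equiv.Perm.sign_swap hab]
    simp
  · have hfT : (fun k => sperm n j (f k)) =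
        (S.image (sperm n j)).orderEmbOfFin (card_image_perm _ _) := by
      apply Finset.orderEmbOfFin_unique
      · intro k; exact Finset.mem_image_of_mem _ (hfS k)
      · intro k l hkl
        apply sperm_lt h1 h2 (f.strictMono hkl)
        rintro ⟨_, e⟩
        apply hbS
        have : f l = b := Fin.ext (by omega)
        rw [← this]; exact hfS l
    rw [← hfT]
    congr 1
    ext r c
    rw [Matrix.submatrix_apply, mul_sdot_apply h1 h2, sperm_invol]
    have : eps j (f c) = 1 := by
      unfold eps
      rw [if_neg]
      intro e
      apply hbS
      have : f c = b := Fin.ext (by omega)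
      rw [← this]; exact hfS c
    rw [this, mul_one]; rfl

lemma minor_wd_lower (l : List ℕ) (hl : Rd n l) (M : Matrix (Fin n) (Fin n) ℝ)
    (I S : Finset (Fin n)) (hS : ∀ a b : Fin n, a < b → b ∈ S → a ∈ S) :
    minor (M * wd n l) I (S.image ⇑(ppi n l)⁻¹) = minor M I S := by
  induction l using List.reverseRecOn with
  | nil => simp [wd_nil, ppi_nil]
  | append_singleton l j ih =>
    have hj := hl.1 j (by simp)
    rw [wd_append, wd_single, ppi_append, ppi_single, _root_.mul_inv_rev, sperm_inv,
      Equiv.Perm.coe_mul, ← Finset.image_image, ← mul_assoc, minor_mul_sdot hj.1 hj.2, ih hl.left]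
    intro a b ha hb hbS
    have := hl.snoc a b ha hb
    rw [Finset.mem_image] at hbS ⊢
    obtain ⟨y, hy, rfl⟩ := hbS
    rw [perm_apply_inv] at this
    exact ⟨ppi n l a, hS _ _ this hy, by simp⟩

lemma minor_wd_upper (l : List ℕ) (hl : Rd n l) (M : Matrix (Fin n) (Fin n) ℝ)
    (I S : Finset (Fin n)) (hS : ∀ a b : Fin n, a < b → a ∈ S → b ∈ S) :
    minor (M * wd n l) I S = minor M I (S.image ⇑(ppi n l)) := by
  induction l generalizing M with
  | nil => simp [wd_nil, ppi_nil]
  | cons j l ih =>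
    have hj := hl.1 j (by simp)
    rw [wd_cons, ← mul_assoc, ih (Rd.right (l := [j]) hl)]
    rw [← minor_mul_sdot hj.1 hj.2 M I (S.image ⇑(ppi n (j :: l)))]
    · rw [ppi_cons, Equiv.Perm.coe_mul, ← Finset.image_image, Finset.image_image,
        show (sperm n j : Fin n → Fin n) ∘ (sperm n j) = id from funext (sperm_invol j), Finset.image_id]
    · intro a b ha hb hbS
      have hsa : sperm n j a = b := by
        apply Fin.ext; rw [sperm_val hj.1 hj.2]; split_ifs <;> omega
      have := hl.cons a b ha hb
      rw [Finset.mem_image] at hbS ⊢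
      obtain ⟨y, hy, hyb⟩ := hbS
      rw [ppi_cons, Equiv.Perm.mul_apply] at hyb
      have hya : ppi n l y = a := by
        rw [← sperm_invol j (ppi n l y), hyb, ← hsa, sperm_invol]
      refine ⟨(ppi n l)⁻¹ b, hS y _ ?_ hy, ?_⟩
      · rw [← hya] at this; simpa using this
      · rw [ppi_cons, Equiv.Perm.mul_apply, perm_apply_inv, ← hsa, sperm_invol]



/-! Triangular matrices and the Marsh–Rietsch words. -/

/-- upper triangular -/
def Up (M : Matrix (Fin n) (Fin n) ℝ) : Prop := ∀ i j : Fin n, j < i → M i j = 0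

lemma Up.mul {A B : Matrix (Fin n) (Fin n) ℝ} (hA : Up A) (hB : Up B) : Up (A * B) := by
  intro i j hij
  rw [Matrix.mul_apply]
  apply Finset.sum_eq_zero
  intro k _
  by_cases h : k < i
  · rw [hA i k h, zero_mul]
  · rw [hB k j (lt_of_lt_of_le hij (not_lt.1 h)), mul_zero]

lemma Up.mul_diag {A B : Matrix (Fin n) (Fin n) ℝ} (hA : Up A) (hB : Up B) (i : Fin n) :
    (A * B) i i = A i i * B i i := by
  rw [Matrix.mul_apply]
  apply Finset.sum_eq_single i
  · intro k _ hk
    rcases lt_or_gt_of_ne hk with h | h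
    · rw [hA i k h, zero_mul]
    · rw [hB k i h, mul_zero]
  · simp

lemma Up.det {A : Matrix (Fin n) (Fin n) ℝ} (hA : Up A) : A.det = ∏ i, A i i :=
  det_tri (fun i => i) (fun _ _ h => h) A (fun r c h => hA r c h)

lemma Up.inv {A : Matrix (Fin n) (Fin n) ℝ} (hA : Up A) (h : A.det ≠ 0) : Up A⁻¹ := by
  have := Matrix.invertibleOfIsUnitDet A (isUnit_iff_ne_zero.2 h)
  have : A.BlockTriangular id := fun i j hij => hA i j hij
  intro i j hij
  exact Matrix.blockTriangular_inv_of_blockTriangular this hij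

lemma IsN.up {A : Matrix (Fin n) (Fin n) ℝ} (h : IsN A) : Up A := h.2

lemma IsN.det {A : Matrix (Fin n) (Fin n) ℝ} (h : IsN A) : A.det = 1 := by
  rw [h.up.det]; simp [h.1]

lemma IsN.mul {A B : Matrix (Fin n) (Fin n) ℝ} (hA : IsN A) (hB : IsN B) : IsN (A * B) :=
  ⟨fun i => by rw [hA.up.mul_diag hB.up, hA.1, hB.1, one_mul], hA.up.mul hB.up⟩

lemma IsN.inv {A : Matrix (Fin n) (Fin n) ℝ} (hA : IsN A) : IsN A⁻¹ := by
  have hd : A.det ≠ 0 := by rw [hA.det]; exact one_ne_zero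
  have hu := hA.up.inv hd
  refine ⟨fun i => ?_, hu⟩
  have := hA.up.mul_diag hu i
  rw [Matrix.mul_nonsing_inv _ (isUnit_iff_ne_zero.2 hd), hA.1, one_mul] at this
  rw [← this]; simp

lemma isN_one : IsN (1 : Matrix (Fin n) (Fin n) ℝ) :=
  ⟨fun i => by simp, fun i j h => Matrix.one_apply_ne h.ne'⟩

lemma isNm_iff {A : Matrix (Fin n) (Fin n) ℝ} : IsNm A ↔ IsN Aᵀ :=
  ⟨fun h => ⟨h.1, fun i j hij => h.2 j i hij⟩, fun h => ⟨h.1, fun i j hij => h.2 j i hij⟩⟩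

lemma IsNm.mul {A B : Matrix (Fin n) (Fin n) ℝ} (hA : IsNm A) (hB : IsNm B) : IsNm (A * B) := by
  rw [isNm_iff, Matrix.transpose_mul]
  exact (isNm_iff.1 hB).mul (isNm_iff.1 hA)

lemma IsNm.inv {A : Matrix (Fin n) (Fin n) ℝ} (hA : IsNm A) : IsNm A⁻¹ := by
  rw [isNm_iff, Matrix.transpose_nonsing_inv]
  exact (isNm_iff.1 hA).inv

lemma IsNm.det {A : Matrix (Fin n) (Fin n) ℝ} (h : IsNm A) : A.det = 1 := by
  rw [← Matrix.det_transpose]; exact (isNm_iff.1 h).det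

lemma xmat_eq {j : ℕ} (a b : Fin n) (ha : (a : ℕ) + 1 = j) (hb : (b : ℕ) = j) (t : ℝ) :
    (xmat j t : Matrix (Fin n) (Fin n) ℝ) = Matrix.transvection a b t := by
  ext r c
  unfold xmat Matrix.transvection
  rw [Matrix.add_apply, Matrix.one_apply, Matrix.single_apply, Matrix.of_apply]
  have e1 : (a = r ∧ b = c) ↔ ((r : ℕ) + 1 = j ∧ (c : ℕ) = j) := by
    rw [Fin.ext_iff, Fin.ext_iff]; omega
  simp only [e1]
  by_cases h : r = c
  · have : ¬ ((r : ℕ) + 1 = j ∧ (c : ℕ) = j) := by rw [h]; omega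
    rw [if_pos h, if_pos h, if_neg this, add_zero]
  · rw [if_neg h, if_neg h, zero_add]

lemma transv_T (a b : Fin n) (t : ℝ) :
    (Matrix.transvection a b t)ᵀ = Matrix.transvection b a t := by
  simp [Matrix.transvection]

lemma det_xmat {j : ℕ} (h1 : 1 ≤ j) (h2 : j < n) (t : ℝ) :
    (xmat j t : Matrix (Fin n) (Fin n) ℝ).det = 1 := by
  rw [xmat_eq (⟨j - 1, by omega⟩ : Fin n) ⟨j, h2⟩ (by simp; omega) rfl]
  apply Matrix.det_transvection_of_ne
  simp [Fin.ext_iff]; omega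

lemma conj_x {W : Matrix (Fin n) (Fin n) ℝ} {w : Equiv.Perm (Fin n)} (h : Mono W w) (j : ℕ)
    (hlt : ∀ a b : Fin n, (a : ℕ) + 1 = j → (b : ℕ) = j → w a < w b) (t : ℝ) :
    IsN (W * xmat j t * Wᵀ) := by
  obtain ⟨e, he, hc⟩ := h.T.conj
  rw [Matrix.transpose_transpose] at hc
  refine ⟨fun i => ?_, fun r c hrc => ?_⟩
  · rw [hc, he, one_mul]; simp [xmat]
  · rw [hc]
    have : (xmat j t : Matrix (Fin n) (Fin n) ℝ) (w⁻¹ r) (w⁻¹ c) = 0 := by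
      unfold xmat
      rw [Matrix.of_apply, if_neg, if_neg]
      · rintro ⟨h1, h2⟩
        have := hlt _ _ h1 h2
        simp only [perm_apply_inv] at this
        exact absurd this (not_lt.2 hrc.le)
      · intro e; exact hrc.ne' (w⁻¹.injective e)
    rw [this, mul_zero]

lemma sdot_conj_Nm {j : ℕ} (h1 : 1 ≤ j) (h2 : j < n) (D : Matrix (Fin n) (Fin n) ℝ)
    (hd : ∀ i, D i i = 1) (hD : ∀ r c : Fin n, r < c → ¬ ((r : ℕ) + 1 = j ∧ (c : ℕ) = j) → D r c = 0)
    (hba : ∀ a b : Fin n, (a : ℕ) + 1 = j → (b : ℕ) = j → D b a = 0) :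
    IsNm ((sdot j : Matrix (Fin n) (Fin n) ℝ)ᵀ * D * sdot j) := by
  obtain ⟨e, he, hc⟩ := (mono_sdot h1 h2).conj
  refine ⟨fun i => ?_, fun r c hrc => ?_⟩
  · rw [hc, he, one_mul, hd]
  · rw [hc]
    by_cases h : (r : ℕ) + 1 = j ∧ (c : ℕ) = j
    · have hsr : sperm n j r = c := by
        apply Fin.ext; rw [sperm_val h1 h2]; split_ifs <;> omega
      have hsc : sperm n j c = r := by rw [← hsr, sperm_invol]
      rw [hsr, hsc, hba r c h.1 h.2, mul_zero]
    · have hlt := sperm_lt h1 h2 hrc h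
      rw [hD _ _ hlt, mul_zero]
      rintro ⟨e1, e2⟩
      rw [sperm_val h1 h2] at e1 e2
      rw [Fin.lt_def] at hrc
      split_ifs at e1 e2 <;> omega

lemma step_up {j : ℕ} (h1 : 1 ≤ j) (h2 : j < n) (a b : Fin n) (ha : (a : ℕ) + 1 = j)
    (hb : (b : ℕ) = j) (M : Matrix (Fin n) (Fin n) ℝ)
    (hM : ∀ r c : Fin n, c < r → ¬ (r = b ∧ c = a) → M r c = 0) (hba : M b a ≠ 0) :
    ∃ q : ℝ, Up (M * xmat j q * sdot j) := by
  have hab : a ≠ b := by intro e; rw [e] at ha; omega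
  have hsa : sperm n j a = b := by
    apply Fin.ext; rw [sperm_val h1 h2]; split_ifs <;> omega
  have hsb : sperm n j b = a := by rw [← hsa, sperm_invol]
  refine ⟨- M b b / M b a, fun r c hrc => ?_⟩
  rw [mul_sdot_apply h1 h2, xmat_eq a b ha hb]
  by_cases hca : c = a
  · rw [hca, hsa, Matrix.mul_transvection_apply_same]
    by_cases hrb : r = b
    · rw [hrb]; field_simp; simp
    · rw [hca] at hrc
      have hrb' : b < r := by
        rw [Fin.lt_def] at hrc ⊢
        have : (r : ℕ) ≠ b := fun e => hrb (Fin.ext e)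
        omega
      rw [hM r b hrb' (fun h => hrb h.1), hM r a hrc (fun h => hrb h.1)]; simp
  by_cases hcb : c = b
  · rw [hcb, hsb, Matrix.mul_transvection_apply_of_ne _ _ _ _ hab, hM r a]
    · simp
    · rw [hcb] at hrc
      rw [Fin.lt_def] at hrc ⊢; omega
    · rintro ⟨e, _⟩; rw [e, hcb] at hrc; exact lt_irrefl _ hrc
  have hsc : sperm n j c = c := by
    rw [Fin.ext_iff] at hca hcb ⊢
    rw [sperm_val h1 h2]; split_ifs <;> omega
  rw [hsc, Matrix.mul_transvection_apply_of_ne _ _ _ _ hcb, hM r c hrc (fun h => hca h.2), zero_mul]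

/-- factor of the Marsh–Rietsch element -/
def gm (n : ℕ) (e : ℕ × Option ℝ) : Matrix (Fin n) (Fin n) ℝ :=
  match e.2 with
  | some t => xmat e.1 t
  | none => sdot e.1

/-- Marsh–Rietsch element of a word -/
def gp (n : ℕ) (L : List (ℕ × Option ℝ)) : Matrix (Fin n) (Fin n) ℝ := (L.map (gm n)).prod

/-- the word of `w` -/
def wl (L : List (ℕ × Option ℝ)) : List ℕ := L.map Prod.fst

/-- the word of `v` -/
def vl (L : List (ℕ × Option ℝ)) : List ℕ := (L.filter (fun e => e.2.isNone)).map Prod.fst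

lemma gp_append (L L' : List (ℕ × Option ℝ)) : gp n (L ++ L') = gp n L * gp n L' := by simp [gp]
lemma wl_append (L L' : List (ℕ × Option ℝ)) : wl (L ++ L') = wl L ++ wl L' := by simp [wl]
lemma vl_append (L L' : List (ℕ × Option ℝ)) : vl (L ++ L') = vl L ++ vl L' := by simp [vl]
lemma gp_single (e : ℕ × Option ℝ) : gp n [e] = gm n e := by simp [gp]

lemma det_gp (L : List (ℕ × Option ℝ)) (hL : Gd n (wl L)) : (gp n L).det = 1 := by
  induction L with
  | nil => simp [gp]
  | cons e L ih =>
    have : gp n (e :: L) = gm n e * gp n L := by simp [gp]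
    rw [this, Matrix.det_mul, ih (fun j hj => hL j (by simp [wl] at hj ⊢; exact Or.inr hj)), mul_one]
    have hj := hL e.1 (by simp [wl])
    obtain ⟨j, _ | t⟩ := e
    · exact det_sdot hj.1 hj.2
    · exact det_xmat hj.1 hj.2 t

lemma step_gm (e : ℕ × Option ℝ) (h1 : 1 ≤ e.1) (h2 : e.1 < n) (ht : ∀ t, e.2 = some t → t ≠ 0)
    (B : Matrix (Fin n) (Fin n) ℝ) (hB : Up B) (hd : B.det ≠ 0) :
    ∃ q : ℝ, Up ((gm n e)ᵀ * B * xmat e.1 q * sdot e.1) := by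
  obtain ⟨j, o⟩ := e
  simp only at h1 h2 ht ⊢
  obtain ⟨a, ha⟩ : ∃ a : Fin n, (a : ℕ) + 1 = j := ⟨⟨j - 1, by omega⟩, by simp; omega⟩
  obtain ⟨b, hb⟩ : ∃ b : Fin n, (b : ℕ) = j := ⟨⟨j, h2⟩, rfl⟩
  have hab : a < b := by rw [Fin.lt_def]; omega
  have hsa : sperm n j a = b := by
    apply Fin.ext; rw [sperm_val h1 h2]; split_ifs <;> omega
  have hsb : sperm n j b = a := by rw [← hsa, sperm_invol]
  have hBa : B a a ≠ 0 := by
    rw [hB.det, Finset.prod_ne_zero_iff] at hd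
    exact hd a (mem_univ _)
  apply step_up h1 h2 a b ha hb
  · intro r c hrc hne
    rcases o with _ | t
    · simp only [gm]
      rw [sdotT_mul_apply h1 h2]
      have : B (sperm n j r) c = 0 := by
        apply hB
        rw [Fin.ext_iff, Fin.ext_iff] at hne
        rw [Fin.lt_def] at hrc ⊢
        rw [sperm_val h1 h2]; split_ifs <;> omega
      rw [this, mul_zero]
    · simp only [gm]
      rw [xmat_eq a b ha hb, transv_T]
      by_cases hrb : r = b
      · rw [hrb, Matrix.transvection_mul_apply_same, hB b c (hrb ▸ hrc), hB a c]
        · simp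
        · rw [hrb] at hrc
          have : c ≠ a := fun h => hne ⟨hrb, h⟩
          rw [ne_eq, Fin.ext_iff] at this
          rw [Fin.lt_def] at hrc ⊢; omega
      · rw [Matrix.transvection_mul_apply_of_ne _ _ _ _ hrb, hB r c hrc]
  · rcases o with _ | t
    · simp only [gm]
      rw [sdotT_mul_apply h1 h2, hsb]
      apply mul_ne_zero _ hBa
      intro h
      have := eps_sq j a
      rw [h] at this; simp at this
    · simp only [gm]
      rw [xmat_eq a b ha hb, transv_T, Matrix.transvection_mul_apply_same,
        hB b a hab, zero_add]
      exact mul_ne_zero (ht t rfl) hBa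

/-- distinguished subword -/
def Dist (n : ℕ) (L : List (ℕ × Option ℝ)) : Prop :=
  ∀ p e q, L = p ++ e :: q → ∀ a b : Fin n, (a : ℕ) + 1 = e.1 → (b : ℕ) = e.1 →
    ppi n (vl p) a < ppi n (vl p) b

lemma Dist.left {L L' : List (ℕ × Option ℝ)} (h : Dist n (L ++ L')) : Dist n L := by
  intro p e q hL
  apply h p e (q ++ L')
  rw [hL]; simp

lemma vl_Rd (L : List (ℕ × Option ℝ)) (hL : Gd n (wl L)) (hD : Dist n L) : Rd n (vl L) := by
  induction L using List.reverseRecOn with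
  | nil => exact ⟨fun j hj => by simp [vl] at hj, by simp [vl, ppi_nil, len_one]⟩
  | append_singleton L e ih =>
    rw [wl_append] at hL
    have ih' := ih hL.left hD.left
    have hj := hL e.1 (by simp [wl])
    rw [vl_append]
    have hlt := hD L e [] rfl
    obtain ⟨j, _ | t⟩ := e
    · exact ih'.mk_snoc hj.1 hj.2 hlt
    · simpa [vl] using ih'

lemma gp_eq (L : List (ℕ × Option ℝ)) (hL : Gd n (wl L)) (hD : Dist n L) :
    ∃ N : Matrix (Fin n) (Fin n) ℝ, IsN N ∧ gp n L = N * wd n (vl L) := by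
  induction L using List.reverseRecOn with
  | nil => exact ⟨1, isN_one, by simp [gp, vl, wd_nil]⟩
  | append_singleton L e ih =>
    rw [wl_append] at hL
    obtain ⟨N, hN, hg⟩ := ih hL.left hD.left
    have hj := hL e.1 (by simp [wl])
    rw [vl_append, gp_append, gp_single, hg, wd_append]
    have hlt := hD L e [] rfl
    have hm := mono_wd _ (vl_Rd L hL.left hD.left).1
    obtain ⟨j, _ | t⟩ := e
    · refine ⟨N, hN, ?_⟩
      rw [mul_assoc]; simp [gm, vl, wd_single]
    · refine ⟨N * (wd n (vl L) * xmat j t * (wd n (vl L))ᵀ), hN.mul (conj_x hm j hlt t), ?_⟩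
      have e1 : wd n (vl [(j, some t)]) = 1 := by simp [vl, wd_nil]
      rw [e1, mul_one]
      simp only [mul_assoc, hm.T_mul, mul_one, gm]

lemma exists_V (L : List (ℕ × Option ℝ)) (hL : Rd n (wl L))
    (hnz : ∀ e ∈ L, ∀ t, e.2 = some t → t ≠ 0) :
    ∃ V : Matrix (Fin n) (Fin n) ℝ, IsN V ∧ IsNm ((wd n (wl L))ᵀ * V * wd n (wl L)) ∧
      ∀ p q, L = p ++ q → Up ((gp n p)ᵀ * V * wd n (wl p)) := by
  induction L using List.reverseRecOn with
  | nil =>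
    refine ⟨1, isN_one, ?_, ?_⟩
    · simp only [wl, List.map_nil, wd_nil, Matrix.transpose_one, mul_one]
      rw [isNm_iff, Matrix.transpose_one]; exact isN_one
    · intro p q h
      have hp : p = [] := (List.append_eq_nil_iff.1 h.symm).1
      subst hp
      simp only [gp, wl, List.map_nil, wd_nil, Matrix.transpose_one, mul_one, List.prod_nil]
      exact isN_one.up
  | append_singleton L e ih =>
    have hL' := hL
    rw [wl_append] at hL
    obtain ⟨V, hV, hVm, hX⟩ := ih hL.left (fun e' he' => hnz e' (by simp [he']))
    have hj := hL.1 e.1 (by simp [wl])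
    set W := wd n (wl L) with hW
    have hm : Mono W (ppi n (wl L)) := mono_wd _ hL.left.1
    have hB := hX L [] (by simp)
    obtain ⟨q0, hq⟩ := step_gm e hj.1 hj.2 (hnz e (by simp)) _ hB (by
      rw [Matrix.det_mul, Matrix.det_mul, Matrix.det_transpose, det_gp L hL.left.1, hV.det,
        det_wd _ hL.left.1]; norm_num)
    have hlt := Rd.snoc (l := wl L) (j := e.1) hL
    have hwd : wd n (wl (L ++ [e])) = W * sdot e.1 := by
      rw [wl_append, wd_append]; simp [wl, wd_single, hW]
    have hXN : IsN (W * xmat e.1 q0 * Wᵀ) := conj_x hm e.1 hlt q0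
    refine ⟨V * (W * xmat e.1 q0 * Wᵀ), hV.mul hXN, ?_, ?_⟩
    · have e1 : (wd n (wl (L ++ [e])))ᵀ * (V * (W * xmat e.1 q0 * Wᵀ)) * wd n (wl (L ++ [e])) =
          ((sdot e.1)ᵀ * (Wᵀ * V * W) * sdot e.1) * ((sdot e.1)ᵀ * xmat e.1 q0 * sdot e.1) := by
        rw [hwd, Matrix.transpose_mul]
        have h1 := hm.T_mul
        have h2 := (mono_sdot (n := n) hj.1 hj.2).mul_T
        calc _ = (sdot e.1)ᵀ * (Wᵀ * V * W) * xmat e.1 q0 * (Wᵀ * W) * sdot e.1 := by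
              simp only [mul_assoc]
          _ = (sdot e.1)ᵀ * (Wᵀ * V * W) * (sdot e.1 * (sdot e.1)ᵀ) * xmat e.1 q0 * sdot e.1 := by
              rw [h1, h2, mul_one, mul_one]
          _ = _ := by simp only [mul_assoc]
      rw [e1]
      apply IsNm.mul
      · apply sdot_conj_Nm hj.1 hj.2
        · exact hVm.1
        · intro r c hrc _; exact hVm.2 r c hrc
        · intro a b ha hb
          obtain ⟨ee, _, hc⟩ := hm.conj
          rw [hc, hV.2 _ _ (hlt a b ha hb), mul_zero]
      · apply sdot_conj_Nm hj.1 hj.2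
        · intro i; simp [xmat]
        · intro r c hrc hne
          unfold xmat
          rw [Matrix.of_apply, if_neg hrc.ne, if_neg hne]
        · intro a b ha hb
          unfold xmat
          rw [Matrix.of_apply, if_neg, if_neg]
          · omega
          · intro h; rw [h] at hb; omega
    · intro p q hpq
      rcases List.eq_nil_or_concat q with hq' | ⟨q', e', hq'⟩
      · subst hq'
        rw [List.append_nil] at hpq
        subst hpq
        rw [hwd, gp_append, gp_single, Matrix.transpose_mul]
        have e2 : (gm n e)ᵀ * (gp n L)ᵀ * (V * (W * xmat e.1 q0 * Wᵀ)) * (W * sdot e.1) =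
          (gm n e)ᵀ * ((gp n L)ᵀ * V * W) * xmat e.1 q0 * sdot e.1 := by
          calc _ = (gm n e)ᵀ * ((gp n L)ᵀ * V * W) * xmat e.1 q0 * (Wᵀ * W) * sdot e.1 := by
                simp only [mul_assoc]
            _ = _ := by rw [hm.T_mul, mul_one]
        rw [e2]; exact hq
      · subst hq'
        rw [List.concat_eq_append, ← List.append_assoc] at hpq
        obtain ⟨h1, h2⟩ := List.append_inj' hpq rfl
        have h3 := hX p q' h1
        rw [h1, wl_append, List.append_assoc] at hL
        have hr : Rd n (wl q' ++ [e.1]) := hL.right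
        have hwq : W = wd n (wl p) * wd n (wl q') := by rw [hW, h1, wl_append, wd_append]
        have hmp : Mono (wd n (wl p)) _ := mono_wd (wl p) hL.left.1
        have hmq : Mono (wd n (wl q')) _ := mono_wd (wl q') hr.left.1
        have e2 : (gp n p)ᵀ * (V * (W * xmat e.1 q0 * Wᵀ)) * wd n (wl p) =
            ((gp n p)ᵀ * V * wd n (wl p)) * (wd n (wl q') * xmat e.1 q0 * (wd n (wl q'))ᵀ) := by
          rw [hwq, Matrix.transpose_mul]
          calc _ = ((gp n p)ᵀ * V * wd n (wl p)) * (wd n (wl q') * xmat e.1 q0 * (wd n (wl q'))ᵀ)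
                * ((wd n (wl p))ᵀ * wd n (wl p)) := by simp only [mul_assoc]
            _ = _ := by rw [hmp.T_mul, mul_one]
        rw [e2]
        exact h3.mul (conj_x hmq e.1 (Rd.snoc hr) q0).up



/-! The main argument. -/

lemma core_minor (p q : List (ℕ × Option ℝ)) (hR : Rd n (wl (p ++ q))) (hD : Dist n (p ++ q))
    (V : Matrix (Fin n) (Fin n) ℝ) (hV : IsN V)
    (hX : Up ((gp n p)ᵀ * V * wd n (wl p)))
    (S T : Finset (Fin n)) (hS : ∀ a b : Fin n, a < b → b ∈ S → a ∈ S) (hT : ∀ x, x ∈ T ↔ x ∉ S) :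
    minor ((gp n (p ++ q))ᵀ * V * wd n (wl (p ++ q))) (S.image ⇑(ppi n (vl q))⁻¹)
      (S.image ⇑(ppi n (wl q))⁻¹) =
    minor V⁻¹ (T.image ⇑(ppi n (wl p))) (T.image ⇑(ppi n (vl p))) := by
  have hvR := vl_Rd _ hR.1 hD
  obtain ⟨N, hN, hgN⟩ := gp_eq _ hR.1 hD
  rw [wl_append] at hR
  obtain ⟨Np, hNp, hgp⟩ := gp_eq p hR.left.1 hD.left
  rw [vl_append] at hvR
  set X := (gp n p)ᵀ * V * wd n (wl p) with hXdef
  have hmwp := mono_wd (wl p) hR.left.1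
  have hmvp := mono_wd (vl p) hvR.left.1
  have hdX : X.det = 1 := by
    rw [hXdef, Matrix.det_mul, Matrix.det_mul, Matrix.det_transpose, det_gp p hR.left.1, hV.det,
      det_wd _ hR.left.1]; norm_num
  have hT' : ∀ a b : Fin n, a < b → a ∈ T → b ∈ T := by
    intro a b hab ha
    rw [hT] at ha ⊢
    exact fun hb => ha (hS a b hab hb)
  have hdN : IsUnit Np.det := by rw [hNp.det]; exact isUnit_one
  have hdXu : IsUnit X.det := by rw [hdX]; exact isUnit_one
  -- left-hand side
  have hgq : gp n q = ((wd n (vl p))ᵀ * (Np⁻¹ * N) * wd n (vl p)) * wd n (vl q) := by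
    have h1 : Np * wd n (vl p) * gp n q = N * (wd n (vl p) * wd n (vl q)) := by
      rw [← hgp, ← wd_append, ← vl_append, ← hgN, gp_append]
    calc gp n q = (wd n (vl p))ᵀ * (Np⁻¹ * Np) * wd n (vl p) * gp n q := by
          rw [Matrix.nonsing_inv_mul _ hdN, mul_one, hmvp.T_mul, one_mul]
      _ = (wd n (vl p))ᵀ * Np⁻¹ * (Np * wd n (vl p) * gp n q) := by simp only [mul_assoc]
      _ = _ := by rw [h1]; simp only [mul_assoc]
  have hLHS : minor ((gp n (p ++ q))ᵀ * V * wd n (wl (p ++ q))) (S.image ⇑(ppi n (vl q))⁻¹)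
      (S.image ⇑(ppi n (wl q))⁻¹) = ∏ c ∈ S, X c c := by
    have e1 : (gp n (p ++ q))ᵀ * V * wd n (wl (p ++ q)) = (gp n q)ᵀ * X * wd n (wl q) := by
      rw [hXdef, gp_append, Matrix.transpose_mul, wl_append, wd_append]
      simp only [mul_assoc]
    rw [e1, minor_wd_lower _ hR.right _ _ _ hS, minor_mul_of, minor_transpose, hgq,
      minor_wd_lower _ hvR.right _ _ _ hS]
    · obtain ⟨e, he, hc⟩ := hmvp.conj
      have hu := hNp.inv.mul hN
      rw [minor_tri _ S (ppi n (vl p)) (ppi n (vl p)).injective,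
        minor_tri X S (fun x => x) (fun _ _ h => h)]
      · rw [Finset.prod_eq_one, one_mul]
        intro c _
        rw [hc, hu.1, he, mul_one]
      · intro r c hrc; exact hX r c hrc
      · intro r c hrc
        rw [hc, hu.2 _ _ hrc, mul_zero]
    · intro c hc k hk
      apply hX
      by_contra hlt
      rcases eq_or_lt_of_le (not_lt.1 hlt) with h | h
      · exact hk (h ▸ hc)
      · exact hk (hS _ _ h hc)
  -- right-hand side
  have hXi : Up X⁻¹ := hX.inv hdXu.ne_zero
  have hRHS : minor V⁻¹ (T.image ⇑(ppi n (wl p))) (T.image ⇑(ppi n (vl p))) =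
      ∏ c ∈ T, X⁻¹ c c := by
    have hdV : IsUnit V.det := by rw [hV.det]; exact isUnit_one
    have e1 : V⁻¹ = wd n (wl p) * X⁻¹ * (gp n p)ᵀ := by
      apply Matrix.inv_eq_left_inv
      have hgu : IsUnit (gp n p)ᵀ.det := by
        rw [Matrix.det_transpose, det_gp p hR.left.1]; exact isUnit_one
      calc wd n (wl p) * X⁻¹ * (gp n p)ᵀ * V
          = wd n (wl p) * X⁻¹ * (gp n p)ᵀ * V * (wd n (wl p) * (wd n (wl p))ᵀ) := by
            rw [hmwp.mul_T, mul_one]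
        _ = wd n (wl p) * (X⁻¹ * X) * (wd n (wl p))ᵀ := by rw [hXdef]; simp only [mul_assoc]
        _ = 1 := by rw [Matrix.nonsing_inv_mul _ hdXu, mul_one, hmwp.mul_T]
    have e2 : (V⁻¹)ᵀ * wd n (wl p) = gp n p * (X⁻¹)ᵀ := by
      rw [e1, Matrix.transpose_mul, Matrix.transpose_mul, Matrix.transpose_transpose, mul_assoc,
        mul_assoc, hmwp.T_mul, mul_one]
    rw [← minor_transpose, ← minor_wd_upper _ hR.left _ _ _ hT', e2, minor_mul_of, hgp,
      minor_wd_upper _ hvR.left _ _ _ hT', minor_transpose]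
    · rw [minor_tri Np _ (fun x => x) (fun _ _ h => h) (fun r c h => hNp.2 r c h),
        minor_tri X⁻¹ _ (fun x => x) (fun _ _ h => h) (fun r c h => hXi r c h),
        Finset.prod_eq_one (fun c _ => hNp.1 c), one_mul]
    · intro c hc k hk
      rw [Matrix.transpose_apply]
      apply hXi
      by_contra hlt
      rcases eq_or_lt_of_le (not_lt.1 hlt) with h | h
      · exact hk (h ▸ hc)
      · exact hk (hT' _ _ h hc)
  rw [hLHS, hRHS]
  have hdiag : ∀ c, X c c * X⁻¹ c c = 1 := by
    intro c
    rw [← hX.mul_diag hXi, Matrix.mul_nonsing_inv _ hdXu]; simp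
  have hall : (∏ c ∈ S, X c c) * ∏ c ∈ T, X c c = 1 := by
    have hTc : T = Sᶜ := by ext x; rw [hT, Finset.mem_compl]
    rw [hTc, Finset.prod_mul_prod_compl, ← hX.det, hdX]
  have h2 : (∏ c ∈ T, X c c) * ∏ c ∈ T, X⁻¹ c c = 1 := by
    rw [← Finset.prod_mul_distrib]
    exact Finset.prod_eq_one (fun c _ => hdiag c)
  calc _ = (∏ c ∈ S, X c c) * ((∏ c ∈ T, X c c) * ∏ c ∈ T, X⁻¹ c c) := by rw [h2, mul_one]
    _ = _ := by rw [← mul_assoc, hall, one_mul]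

lemma ul_unique {P P' c c' : Matrix (Fin n) (Fin n) ℝ} (hP : Up P) (hP' : Up P')
    (hd' : P'.det = 1) (hc : IsNm c) (hc' : IsNm c')
    (h : P * c = P' * c') : P = P' ∧ c = c' := by
  have hPu : IsUnit P'.det := by rw [hd']; exact isUnit_one
  have hcu : IsUnit c.det := by rw [hc.det]; exact isUnit_one
  have hQ : P'⁻¹ * P = c' * c⁻¹ := by
    calc P'⁻¹ * P = P'⁻¹ * (P * c) * c⁻¹ := by
          rw [mul_assoc, mul_assoc, Matrix.mul_nonsing_inv _ hcu, mul_one]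
      _ = (P'⁻¹ * P') * c' * c⁻¹ := by rw [h]; simp only [mul_assoc]
      _ = _ := by rw [Matrix.nonsing_inv_mul _ hPu, one_mul]
  have hU : Up (P'⁻¹ * P) := (hP'.inv hPu.ne_zero).mul hP
  have hL : IsNm (c' * c⁻¹) := hc'.mul hc.inv
  have h1 : P'⁻¹ * P = 1 := by
    ext r s
    rcases lt_trichotomy r s with hrs | hrs | hrs
    · rw [Matrix.one_apply_ne hrs.ne, hQ]; exact hL.2 _ _ hrs
    · subst hrs; rw [Matrix.one_apply_eq, hQ]; exact hL.1 _
    · rw [Matrix.one_apply_ne hrs.ne']; exact hU _ _ hrs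
  constructor
  · calc P = P' * P'⁻¹ * P := by rw [Matrix.mul_nonsing_inv _ hPu, one_mul]
      _ = P' := by rw [mul_assoc, h1, mul_one]
  · rw [hQ] at h1
    calc c = (c' * c⁻¹) * c := by rw [h1, one_mul]
      _ = c' := by rw [mul_assoc, Matrix.nonsing_inv_mul _ hcu, mul_one]

lemma up_factor {B : Matrix (Fin n) (Fin n) ℝ} (hB : Up B) (hd : B.det = 1) :
    ∃ a b : Matrix (Fin n) (Fin n) ℝ, IsN a ∧ IsH b ∧ a * b = B := by
  have hne : ∀ i, B i i ≠ 0 := by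
    have : B.det ≠ 0 := by rw [hd]; exact one_ne_zero
    rw [hB.det, Finset.prod_ne_zero_iff] at this
    exact fun i => this i (mem_univ _)
  refine ⟨B * Matrix.diagonal (fun i => (B i i)⁻¹), Matrix.diagonal (fun i => B i i), ?_, ?_, ?_⟩
  · refine ⟨fun i => ?_, fun i j hij => ?_⟩
    · rw [Matrix.mul_diagonal, mul_inv_cancel₀ (hne i)]
    · rw [Matrix.mul_diagonal, hB i j hij, zero_mul]
  · refine ⟨?_, fun i j hij => Matrix.diagonal_apply_ne _ hij⟩
    rw [Matrix.det_diagonal, ← hB.det, hd]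
  · rw [mul_assoc, Matrix.diagonal_mul_diagonal]
    have : (fun i => (B i i)⁻¹ * B i i) = fun _ => (1 : ℝ) := by
      funext i; exact inv_mul_cancel₀ (hne i)
    rw [this, Matrix.diagonal_one, mul_one]

/-- the combined word -/
def Lof (ii : Fin m → ℕ) (v : Equiv.Perm (Fin n)) (t : Fin m → ℝ) : List (ℕ × Option ℝ) :=
  List.ofFn fun r => (ii r, if inJ ii v r then some (t r) else none)

/-- letters of `v` -/
def svp (n : ℕ) (e : ℕ × Option ℝ) : Equiv.Perm (Fin n) :=
  match e.2 with
  | some _ => 1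
  | none => sperm n e.1

lemma svp_prod (L : List (ℕ × Option ℝ)) : (L.map (svp n)).prod = ppi n (vl L) := by
  induction L with
  | nil => simp [vl, ppi_nil]
  | cons e L ih =>
    rw [List.map_cons, List.prod_cons, ih]
    obtain ⟨j, _ | t⟩ := e
    · simp [vl, svp, ppi_cons]
    · simp [vl, svp]

lemma sPermList_eq (ii : Fin m → ℕ) (v : Equiv.Perm (Fin n)) (t : Fin m → ℝ) :
    sPermList n ii = (wl (Lof ii v t)).map (sperm n) := by
  unfold sPermList wl Lof
  rw [List.map_ofFn, List.map_ofFn]; rfl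

lemma svPermList_eq (ii : Fin m → ℕ) (v : Equiv.Perm (Fin n)) (t : Fin m → ℝ) :
    svPermList ii v = (Lof ii v t).map (svp n) := by
  unfold svPermList Lof
  rw [List.map_ofFn]
  congr 1
  funext r
  by_cases h : inJ ii v r <;> simp [svp, h]

lemma mrg_eq (ii : Fin m → ℕ) (v : Equiv.Perm (Fin n)) (t : Fin m → ℝ) :
    mrg ii v t = gp n (Lof ii v t) := by
  unfold mrg mrgList gp Lof
  rw [List.map_ofFn]
  congr 2
  funext r
  by_cases h : inJ ii v r <;> simp [gm, h]

lemma wMR_eq (ii : Fin m → ℕ) (v : Equiv.Perm (Fin n)) (t : Fin m → ℝ) :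
    (wMR n ii : Matrix (Fin n) (Fin n) ℝ) = wd n (wl (Lof ii v t)) := by
  unfold wMR sdotList wd wl Lof
  rw [List.map_ofFn, List.map_ofFn]; rfl

lemma vseq_step (ii : Fin m → ℕ) (v : Equiv.Perm (Fin n)) (r : ℕ) (hr : r < m) :
    vseq ii v (m - r) =
      if len (vseq ii v (m - r - 1) * sperm n (ii ⟨r, hr⟩)) < len (vseq ii v (m - r - 1)) then
        vseq ii v (m - r - 1) * sperm n (ii ⟨r, hr⟩)
      else vseq ii v (m - r - 1) := by
  obtain ⟨k, hk⟩ : ∃ k, m - r = k + 1 := ⟨m - r - 1, by omega⟩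
  have hk' : m - k - 1 = r := by omega
  rw [hk, Nat.add_sub_cancel, vseq]
  subst hk'
  rw [dif_pos hr]

lemma vseq_not_lt (ii : Fin m → ℕ) (v : Equiv.Perm (Fin n)) (r : ℕ) (hr : r < m) :
    ¬ len (vseq ii v (m - r) * sperm n (ii ⟨r, hr⟩)) < len (vseq ii v (m - r)) := by
  rw [vseq_step ii v r hr]
  split_ifs with h
  · rw [mul_assoc, sperm_mul_self, mul_one]; omega
  · exact h

lemma vl_take (ii : Fin m → ℕ) (v : Equiv.Perm (Fin n)) (hv0 : vseq ii v m = 1) (t : Fin m → ℝ)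
    (r : ℕ) (hr : r ≤ m) : ppi n (vl ((Lof ii v t).take r)) = vseq ii v (m - r) := by
  induction r with
  | zero => simp [vl, ppi_nil, hv0]
  | succ r ih =>
    have hlen : r < (Lof ii v t).length := by simp [Lof]; omega
    have hrm : r < m := by omega
    rw [← List.take_concat_get' _ _ hlen, vl_append, ppi_append, ih (by omega)]
    have hget : (Lof ii v t)[r] = (ii ⟨r, hrm⟩, if inJ ii v ⟨r, hrm⟩ then some (t ⟨r, hrm⟩) else none) := by
      simp [Lof]
    rw [hget]
    by_cases h : inJ ii v ⟨r, hrm⟩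
    · rw [if_pos h]
      have h' : vseq ii v (m - r) = vseq ii v (m - r - 1) := h
      rw [h']
      simp [vl, ppi_nil, Nat.sub_sub]
    · rw [if_neg h]
      have h' : ¬ vseq ii v (m - r) = vseq ii v (m - r - 1) := h
      have hs := vseq_step ii v r hrm
      have : vseq ii v (m - r) = vseq ii v (m - r - 1) * sperm n (ii ⟨r, hrm⟩) := by
        rw [hs]
        split_ifs with h2
        · rfl
        · rw [if_neg h2] at hs; exact absurd hs h'
      rw [this]
      have e : ppi n (vl [(ii ⟨r, hrm⟩, none)]) = sperm n (ii ⟨r, hrm⟩) := by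
        simp [vl, ppi_single]
      rw [e, mul_assoc, sperm_mul_self, mul_one, Nat.sub_sub]

lemma dist_Lof (ii : Fin m → ℕ) (hii : ∀ r, 1 ≤ ii r ∧ ii r < n) (v : Equiv.Perm (Fin n))
    (hv0 : vseq ii v m = 1) (t : Fin m → ℝ) : Dist n (Lof ii v t) := by
  intro p e q hL a b ha hb
  have hlen : (Lof ii v t).length = m := by simp [Lof]
  have hpm : p.length < m := by
    rw [← hlen, hL]; simp
  have hp : p = (Lof ii v t).take p.length := by rw [hL]; simp
  have he : e.1 = ii ⟨p.length, hpm⟩ := by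
    have h1 : (Lof ii v t)[p.length]'(by omega) = e := by
      simp [hL]
    rw [← h1]; simp [Lof]
  rw [hp, vl_take ii v hv0 t _ hpm.le]
  have hnl := vseq_not_lt ii v p.length hpm
  have hj := hii ⟨p.length, hpm⟩
  set j := ii ⟨p.length, hpm⟩ with hjdef
  rw [he] at ha hb
  by_contra hc
  apply hnl
  have ea : ∀ h, a = ⟨j - 1, h⟩ := fun _ => Fin.ext (by simp; omega)
  have eb : b = ⟨j, hj.2⟩ := Fin.ext (by simp; omega)
  rw [eb, ea (lt_of_le_of_lt (Nat.sub_le _ _) hj.2)] at hc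
  have := len_mul_sperm' hj.1 hj.2 _ hc
  omega


/-- relating the left and right twist chamber minors (Corollary 7.6, type A). -/
theorem statement_7 {n m : ℕ} (hn : 1 ≤ n) (ii : Fin m → ℕ)
    (hii : ∀ r, 1 ≤ ii r ∧ ii r < n)
    (w : Equiv.Perm (Fin n)) (hw : w = (sPermList n ii).prod) (hred : len w = m)
    (v : Equiv.Perm (Fin n)) (hv0 : vseq ii v m = 1)
    (t : Fin m → ℝ) (ht : ∀ r, inJ ii v r → 0 < t r) :
    (∃ a b c, UDL ((mrg ii v t)ᵀ * wMR n ii) a b c) ∧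
    ∀ a b c, UDL ((mrg ii v t)ᵀ * wMR n ii) a b c →
      IsN ((wMR n ii : Matrix (Fin n) (Fin n) ℝ) * c * (wMR n ii : Matrix (Fin n) (Fin n) ℝ)⁻¹) ∧
      ∀ i r : ℕ, 1 ≤ i → i ≤ n - 1 → 1 ≤ r → r ≤ m + 1 →
        let z := ((wMR n ii : Matrix (Fin n) (Fin n) ℝ) * c *
          (wMR n ii : Matrix (Fin n) (Fin n) ℝ)⁻¹)ᵀ
        minor (a * b)
          ((univ.filter fun x : Fin n => (x : ℕ) < i).image
            ⇑(((svPermList ii v).drop (r - 1)).reverse.prod))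
          ((univ.filter fun x : Fin n => (x : ℕ) < i).image
            ⇑(((sPermList n ii).drop (r - 1)).reverse.prod))
        =
        minor zᵀ
          ((univ.filter fun x : Fin n => i ≤ (x : ℕ)).image
            ⇑(((sPermList n ii).take (r - 1)).prod))
          ((univ.filter fun x : Fin n => i ≤ (x : ℕ)).image
            ⇑(((svPermList ii v).take (r - 1)).prod)) := by
  set L := Lof ii v t with hLdef
  have hlen : L.length = m := by simp [hLdef, Lof]
  have hR : Rd n (wl L) := by
    refine ⟨?_, ?_⟩
    · intro j hj
      simp only [wl, hLdef, Lof, List.map_ofFn, List.mem_ofFn] at hj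
      obtain ⟨r, rfl⟩ := hj
      exact hii r
    · have : ppi n (wl L) = w := by rw [hw, sPermList_eq ii v t]; rfl
      rw [this, hred]; simp [wl, hlen]
  have hD : Dist n L := dist_Lof ii hii v hv0 t
  have hnz : ∀ e ∈ L, ∀ s, e.2 = some s → s ≠ 0 := by
    intro e he s hs
    simp only [hLdef, Lof, List.mem_ofFn] at he
    obtain ⟨r, rfl⟩ := he
    by_cases h : inJ ii v r
    · simp only [if_pos h, Option.some.injEq] at hs
      rw [← hs]; exact (ht r h).ne'
    · simp [if_neg h] at hs
  obtain ⟨V, hV, hVm, hX⟩ := exists_V L hR hnz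
  rw [mrg_eq, wMR_eq ii v t, ← hLdef]
  set W := wd n (wl L) with hW
  have hm := mono_wd (wl L) hR.1
  have hB := hX L [] (by simp)
  have hdV : IsUnit V.det := by rw [hV.det]; exact isUnit_one
  have hdB : ((gp n L)ᵀ * V * W).det = 1 := by
    rw [Matrix.det_mul, Matrix.det_mul, Matrix.det_transpose, det_gp L hR.1, hV.det,
      det_wd _ hR.1]; norm_num
  have hcinv : (Wᵀ * V * W)⁻¹ = Wᵀ * V⁻¹ * W := by
    apply Matrix.inv_eq_left_inv
    calc Wᵀ * V⁻¹ * W * (Wᵀ * V * W) = Wᵀ * V⁻¹ * (W * Wᵀ) * V * W := by simp only [mul_assoc]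
      _ = Wᵀ * (V⁻¹ * V) * W := by rw [hm.mul_T, mul_one]; simp only [mul_assoc]
      _ = 1 := by rw [Matrix.nonsing_inv_mul _ hdV, mul_one, hm.T_mul]
  have hc0 : IsNm (Wᵀ * V⁻¹ * W) := by rw [← hcinv]; exact hVm.inv
  have hfac : (gp n L)ᵀ * W = ((gp n L)ᵀ * V * W) * (Wᵀ * V⁻¹ * W) := by
    calc (gp n L)ᵀ * W = (gp n L)ᵀ * (V * V⁻¹) * W := by
          rw [Matrix.mul_nonsing_inv _ hdV, mul_one]
      _ = (gp n L)ᵀ * V * (W * Wᵀ) * V⁻¹ * W := by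
          rw [hm.mul_T, mul_one]; simp only [mul_assoc]
      _ = _ := by simp only [mul_assoc]
  constructor
  · obtain ⟨a, b, ha, hb, hab⟩ := up_factor hB hdB
    exact ⟨a, b, _, ha, hb, hc0, by rw [hab]; exact hfac⟩
  · rintro a b c ⟨ha, hb, hc, habc⟩
    have hbU : Up b := fun i j hij => hb.2 i j hij.ne'
    obtain ⟨hab, hcc⟩ := ul_unique (ha.up.mul hbU) hB hdB hc hc0 (habc.symm.trans hfac)
    have hz : W * c * W⁻¹ = V⁻¹ := by
      rw [hcc, hm.inv]
      calc W * (Wᵀ * V⁻¹ * W) * Wᵀ = (W * Wᵀ) * V⁻¹ * (W * Wᵀ) := by simp only [mul_assoc]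
        _ = V⁻¹ := by rw [hm.mul_T, mul_one, one_mul]
    rw [hz]
    refine ⟨hV.inv, ?_⟩
    intro i r _ _ _ _
    dsimp only
    rw [Matrix.transpose_transpose, hab]
    have hsplit : L.take (r - 1) ++ L.drop (r - 1) = L := List.take_append_drop _ _
    have key := core_minor (L.take (r - 1)) (L.drop (r - 1)) (by rw [hsplit]; exact hR)
      (by rw [hsplit]; exact hD) V hV (hX _ _ hsplit.symm)
      (univ.filter fun x : Fin n => (x : ℕ) < i) (univ.filter fun x : Fin n => i ≤ (x : ℕ))
      (by
        intro x y hxy hy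
        rw [Finset.mem_filter] at hy ⊢
        rw [Fin.lt_def] at hxy
        exact ⟨mem_univ _, by omega⟩)
      (by
        intro x
        rw [Finset.mem_filter, Finset.mem_filter]
        simp)
    rw [hsplit, ← hW] at key
    have e1 : ((svPermList ii v).drop (r - 1)).reverse.prod = (ppi n (vl (L.drop (r - 1))))⁻¹ := by
      rw [svPermList_eq ii v t, ← hLdef, ← List.map_drop, prod_reverse_invol, svp_prod]
      intro x hx
      obtain ⟨⟨j, _ | s⟩, _, rfl⟩ := List.mem_map.1 hx
      · exact sperm_inv j
      · exact inv_one
    have e2 : ((sPermList n ii).drop (r - 1)).reverse.prod = (ppi n (wl (L.drop (r - 1))))⁻¹ := by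
      rw [sPermList_eq ii v t, ← hLdef, ← List.map_drop, prod_reverse_invol]
      · simp [wl, ppi, List.map_drop]
      · intro x hx
        obtain ⟨j, _, rfl⟩ := List.mem_map.1 hx
        exact sperm_inv j
    have e3 : ((sPermList n ii).take (r - 1)).prod = ppi n (wl (L.take (r - 1))) := by
      rw [sPermList_eq ii v t, ← hLdef]
      simp [wl, ppi, List.map_take]
    have e4 : ((svPermList ii v).take (r - 1)).prod = ppi n (vl (L.take (r - 1))) := by
      rw [svPermList_eq ii v t, ← hLdef, ← List.map_take, svp_prod]
    rw [e1, e2, e3, e4]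
    exact key

end
end Paper
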